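/- Let s ≥ 4, d ≥ 2, and let v_{i,j} ∈ ℝ^d for 1 ≤ i < j ≤ s. Suppose: (1) for every 1 ≤ i < j < k ≤ s there exist nonzero real numbers a_{i,j,k}, b_{i,j,k}, c_{i,j,k} with a_{i,j,k} v_{i,j} − b_{i,j,k} v_{i,k} + c_{i,j,k} v_{j,k} = 0; (2) for every 1 ≤ i < j < k < l ≤ s and every 1 ≤ a ≤ d there exists b such that for all i₁ < i₂ < i₃ in {i, j, k, l} the 2 × 3 matrix with rows (v_{i₁,i₂}^a, v_{i₁,i₃}^a, v_{i₂,i₃}^a) and (v_{i₁,i₂}^b, v_{i₁,i₃}^b, v_{i₂,i₃}^b) has rank 2; (3) (v_{i,j})_{1≤i<j≤s} has S²-rank equal to 1. Then there exist p_i ∈ ℝ^d for 1 ≤ i ≤ s and nonzero λ_{i,j} ∈ ℝ for 1 ≤ i < j ≤ s such that λ_{i,j} v_{i,j} = p_j − p_i for all 1 ≤ i < j ≤ s. -/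

import Mathlib

/-- The `det^{S²}` map on six vectors `v_{i,j} ∈ k²`, `1 ≤ i < j ≤ 4`,
indexed here by `i j : Fin 4` (pair `(i,j)` of the paper corresponds to `(i-1, j-1)`). -/
def detS2 {k : Type*} [Field k] (v : Fin 4 → Fin 4 → k × k) : k :=
  (v 0 1).1 * (v 1 2).1 * (v 2 3).1 * (v 0 2).2 * (v 1 3).2 * (v 0 3).2
  + (v 0 1).1 * (v 1 2).2 * (v 2 3).1 * (v 0 2).2 * (v 1 3).2 * (v 0 3).1
  + (v 0 1).1 * (v 1 2).2 * (v 2 3).2 * (v 0 2).1 * (v 1 3).1 * (v 0 3).2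
  + (v 0 1).2 * (v 1 2).2 * (v 2 3).1 * (v 0 2).1 * (v 1 3).1 * (v 0 3).2
  + (v 0 1).2 * (v 1 2).1 * (v 2 3).2 * (v 0 2).2 * (v 1 3).1 * (v 0 3).1
  + (v 0 1).2 * (v 1 2).1 * (v 2 3).2 * (v 0 2).1 * (v 1 3).2 * (v 0 3).1
  - (v 0 1).2 * (v 1 2).2 * (v 2 3).2 * (v 0 2).1 * (v 1 3).1 * (v 0 3).1
  - (v 0 1).2 * (v 1 2).1 * (v 2 3).2 * (v 0 2).1 * (v 1 3).1 * (v 0 3).2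
  - (v 0 1).2 * (v 1 2).1 * (v 2 3).1 * (v 0 2).2 * (v 1 3).2 * (v 0 3).1
  - (v 0 1).1 * (v 1 2).1 * (v 2 3).2 * (v 0 2).2 * (v 1 3).2 * (v 0 3).1
  - (v 0 1).1 * (v 1 2).2 * (v 2 3).1 * (v 0 2).1 * (v 1 3).2 * (v 0 3).2
  - (v 0 1).1 * (v 1 2).2 * (v 2 3).1 * (v 0 2).2 * (v 1 3).1 * (v 0 3).2


/-- A family `(v_{i,j})_{1 ≤ i < j ≤ s}` of vectors in `ℝ^d` (with `v i j a` the `a`-th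
coordinate of `v_{i,j}`, `1 ≤ a ≤ d`) has `S²`-rank equal to `1` if every `2`-minor has
vanishing `det^{S²}`. -/
def S2RankOne (s d : ℕ) (v : ℕ → ℕ → ℕ → ℝ) : Prop :=
  ∀ x₁ x₂ x₃ x₄ : ℕ, 1 ≤ x₁ → x₁ < x₂ → x₂ < x₃ → x₃ < x₄ → x₄ ≤ s →
  ∀ a₁ a₂ : ℕ, 1 ≤ a₁ → a₁ < a₂ → a₂ ≤ d →
    detS2 (fun p q : Fin 4 =>
      (v (![x₁, x₂, x₃, x₄] p) (![x₁, x₂, x₃, x₄] q) a₁,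
       v (![x₁, x₂, x₃, x₄] p) (![x₁, x₂, x₃, x₄] q) a₂)) = 0

/-- If the `2 × 3` matrix with rows `(x₁, x₂, x₃)`, `(y₁, y₂, y₃)` has rank `2` and its columns
satisfy a linear relation involving the third one, then its first two columns are independent. -/
theorem minor_ne_zero_of_rank_eq_two {x₁ x₂ x₃ y₁ y₂ y₃ a b c : ℝ} (hc : c ≠ 0)
    (hx : a * x₁ - b * x₂ + c * x₃ = 0) (hy : a * y₁ - b * y₂ + c * y₃ = 0)
    (hr : (Matrix.of ![![x₁, x₂, x₃], ![y₁, y₂, y₃]]).rank = 2) :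
    x₁ * y₂ - x₂ * y₁ ≠ 0 := by
  intro h
  have hli : LinearIndependent ℝ (Matrix.of ![![x₁, x₂, x₃], ![y₁, y₂, y₃]]).row := by
    rw [linearIndependent_iff_card_eq_finrank_span, Set.finrank, ← Matrix.rank_eq_finrank_span_row,
      hr, Fintype.card_fin]
  have key : ∀ s t : ℝ, s * x₁ + t * y₁ = 0 → s * x₂ + t * y₂ = 0 → s = 0 ∧ t = 0 := by
    intro s t h₁ h₂
    have h₃ : s * x₃ + t * y₃ = 0 := by
      refine (mul_eq_zero.mp ?_).resolve_left hc
      linear_combination s * hx + t * hy - a * h₁ + b * h₂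
    have hsum := Fintype.linearIndependent_iff.mp hli ![s, t] (by
      ext i
      fin_cases i <;> simpa [Fin.sum_univ_two, Matrix.row])
    exact ⟨hsum 0, hsum 1⟩
  obtain ⟨hy₁, hx₁⟩ := key y₁ (-x₁) (by ring) (by linear_combination -h)
  obtain ⟨hy₂, hx₂⟩ := key y₂ (-x₂) (by linear_combination h) (by ring)
  rw [neg_eq_zero] at hx₁ hx₂
  exact one_ne_zero (key 1 0 (by simp [hx₁]) (by simp [hx₂])).1

/-- For the edge vectors of a planar quadrilateral with vertices `0, p₂, p₃, p₄`, except that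
`v_{3,4} = u` is arbitrary, `det^{S²}` factors. -/
theorem detS2_of_points {k : Type*} [Field k] {v : Fin 4 → Fin 4 → k × k}
    (h₁₂ : v 1 2 = v 0 2 - v 0 1) (h₁₃ : v 1 3 = v 0 3 - v 0 1) :
    detS2 v = ((v 0 1).1 * (v 0 2).2 - (v 0 2).1 * (v 0 1).2) *
      ((v 0 1).1 * (v 0 3).2 - (v 0 3).1 * (v 0 1).2) *
      (((v 0 3).1 - (v 0 2).1) * (v 2 3).2 - ((v 0 3).2 - (v 0 2).2) * (v 2 3).1) := by
  simp only [detS2, h₁₂, h₁₃, Prod.fst_sub, Prod.snd_sub]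
  ring

/-- `det^{S²}` is homogeneous in each of its six arguments. -/
theorem detS2_smul {k : Type*} [Field k] (l : Fin 4 → Fin 4 → k) (v : Fin 4 → Fin 4 → k × k) :
    detS2 (fun p q => l p q • v p q) =
      l 0 1 * l 0 2 * l 0 3 * l 1 2 * l 1 3 * l 2 3 * detS2 v := by
  simp only [detS2, Prod.smul_fst, Prod.smul_snd, smul_eq_mul]
  ring

/-- Coefficients making two triangles of a planar quadruple close up also fit the third triangle
at the common vertex, provided `det^{S²}` vanishes. -/
theorem coeff_mul_eq_of_detS2_eq_zero {k : Type*} [Field k] {v : Fin 4 → Fin 4 → k × k}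
    (hv : detS2 v = 0) {l : Fin 4 → Fin 4 → k} {a b : k}
    (hl₁ : l 0 1 ≠ 0) (hl₂ : l 0 2 ≠ 0) (hl₃ : l 0 3 ≠ 0)
    (h₁₂ : l 0 1 • v 0 1 - l 0 2 • v 0 2 + l 1 2 • v 1 2 = 0)
    (h₁₃ : l 0 1 • v 0 1 - l 0 3 • v 0 3 + l 1 3 • v 1 3 = 0)
    (h₂₃ : a • v 0 2 - b • v 0 3 + l 2 3 • v 2 3 = 0)
    (d₁₂ : (v 0 1).1 * (v 0 2).2 - (v 0 2).1 * (v 0 1).2 ≠ 0)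
    (d₁₃ : (v 0 1).1 * (v 0 3).2 - (v 0 3).1 * (v 0 1).2 ≠ 0)
    (d₂₃ : (v 0 2).1 * (v 0 3).2 - (v 0 3).1 * (v 0 2).2 ≠ 0) :
    a * l 0 3 = b * l 0 2 := by
  have h := detS2_smul l v
  rw [hv, mul_zero, detS2_of_points (by linear_combination h₁₂) (by linear_combination h₁₃)] at h
  have hx := congrArg Prod.fst h₂₃
  have hy := congrArg Prod.snd h₂₃
  simp only [Prod.smul_fst, Prod.smul_snd, smul_eq_mul, Prod.fst_add, Prod.snd_add, Prod.fst_sub,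
    Prod.snd_sub, Prod.fst_zero, Prod.snd_zero] at h hx hy
  have hne : l 0 1 * l 0 2 * (l 0 1 * l 0 3) *
      (((v 0 1).1 * (v 0 2).2 - (v 0 2).1 * (v 0 1).2) *
        ((v 0 1).1 * (v 0 3).2 - (v 0 3).1 * (v 0 1).2) *
        ((v 0 2).1 * (v 0 3).2 - (v 0 3).1 * (v 0 2).2)) ≠ 0 := by
    simp [hl₁, hl₂, hl₃, d₁₂, d₁₃, d₂₃]
  refine sub_eq_zero.mp ((mul_eq_zero.mp ?_).resolve_left hne)
  set K := l 0 1 * l 0 2 * (l 0 1 * l 0 3) *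
    (((v 0 1).1 * (v 0 2).2 - (v 0 2).1 * (v 0 1).2) *
      ((v 0 1).1 * (v 0 3).2 - (v 0 3).1 * (v 0 1).2)) with hK
  linear_combination h - K * (l 0 3 * (v 0 3).1 - l 0 2 * (v 0 2).1) * hy +
    K * (l 0 3 * (v 0 3).2 - l 0 2 * (v 0 2).2) * hx

/-- Variant of the lemma with merely nonzero coefficients `a, b, c` in the dependence
relations: one obtains nonzero `λ_{i,j}` with `λ_{i,j} v_{i,j} = p_j - p_i`. -/
theorem exists_points_of_S2_rank_one_ne_zero (s d : ℕ) (hs : 4 ≤ s) (hd : 2 ≤ d)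
    (v : ℕ → ℕ → ℕ → ℝ)
    (h1 : ∀ i j k : ℕ, 1 ≤ i → i < j → j < k → k ≤ s →
      ∃ a b c : ℝ, a ≠ 0 ∧ b ≠ 0 ∧ c ≠ 0 ∧
        ∀ x : ℕ, 1 ≤ x → x ≤ d → a * v i j x - b * v i k x + c * v j k x = 0)
    (h2 : ∀ i j k l : ℕ, 1 ≤ i → i < j → j < k → k < l → l ≤ s →
      ∀ a : ℕ, 1 ≤ a → a ≤ d → ∃ b : ℕ, 1 ≤ b ∧ b ≤ d ∧
        ∀ i₁ i₂ i₃ : ℕ, i₁ < i₂ → i₂ < i₃ →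
          i₁ ∈ ({i, j, k, l} : Set ℕ) → i₂ ∈ ({i, j, k, l} : Set ℕ) →
          i₃ ∈ ({i, j, k, l} : Set ℕ) →
          (Matrix.of ![![v i₁ i₂ a, v i₁ i₃ a, v i₂ i₃ a],
                       ![v i₁ i₂ b, v i₁ i₃ b, v i₂ i₃ b]]).rank = 2)
    (h3 : S2RankOne s d v) :
    ∃ (p : ℕ → ℕ → ℝ) (l : ℕ → ℕ → ℝ),
      ∀ i j : ℕ, 1 ≤ i → i < j → j ≤ s → l i j ≠ 0 ∧
        ∀ a : ℕ, 1 ≤ a → a ≤ d → l i j * v i j a = p j a - p i a := by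
  have hbase : ∀ j, ∃ m n : ℝ, m ≠ 0 ∧ n ≠ 0 ∧ (j = 2 → m = 1) ∧ (3 ≤ j → j ≤ s →
      ∀ x, 1 ≤ x → x ≤ d → v 1 2 x - m * v 1 j x + n * v 2 j x = 0) := by
    intro j
    by_cases hj : 3 ≤ j ∧ j ≤ s
    · obtain ⟨a, b, c, ha, hb, hc, h⟩ := h1 1 2 j le_rfl (by omega) hj.1 hj.2
      refine ⟨b / a, c / a, div_ne_zero hb ha, div_ne_zero hc ha, by omega, ?_⟩
      intro _ _ x hx hxd
      have := h x hx hxd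
      field_simp
      linear_combination this
    · exact ⟨1, 1, one_ne_zero, one_ne_zero, fun _ => rfl, fun h h' => absurd ⟨h, h'⟩ hj⟩
  choose m n hm hn hm2 hmn using hbase
  have hthird : ∀ j k, 2 ≤ j → j < k → k ≤ s → ∃ μ : ℝ, μ ≠ 0 ∧
      ∀ x, 1 ≤ x → x ≤ d → m j * v 1 j x - m k * v 1 k x + μ * v j k x = 0 := by
    intro j k hj hjk hk
    obtain rfl | hj := hj.eq_or_lt
    · refine ⟨n k, hn k, fun x hx hxd => ?_⟩
      rw [hm2 2 rfl, one_mul]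
      exact hmn k hjk hk x hx hxd
    · obtain ⟨a, b, c, ha, hb, hc, h⟩ := h1 1 j k le_rfl (by omega) hjk hk
      obtain ⟨e, he, hed, hrk⟩ := h2 1 2 j k le_rfl (by omega) hj hjk hk 1 le_rfl (by omega)
      have hj' : j ≤ s := by omega
      have hk' : 3 ≤ k := by omega
      have d₁₂ := minor_ne_zero_of_rank_eq_two (a := 1) (hn j)
        (by simpa using hmn j hj hj' 1 le_rfl (by omega))
        (by simpa using hmn j hj hj' e he hed)
        (hrk 1 2 j (by omega) hj (by simp) (by simp) (by simp))
      have d₁₃ := minor_ne_zero_of_rank_eq_two (a := 1) (hn k)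
        (by simpa using hmn k hk' hk 1 le_rfl (by omega))
        (by simpa using hmn k hk' hk e he hed)
        (hrk 1 2 k (by omega) (by omega) (by simp) (by simp) (by simp))
      have d₂₃ := minor_ne_zero_of_rank_eq_two hc (h 1 le_rfl (by omega)) (h e he hed)
        (hrk 1 j k (by omega) hjk (by simp) (by simp) (by simp))
      have he1 : 1 < e := by
        refine lt_of_le_of_ne he fun h => d₁₂ ?_
        rw [← h]
        ring
      have heq : a * m k = b * m j :=
        coeff_mul_eq_of_detS2_eq_zero
          (h3 1 2 j k le_rfl (by omega) hj hjk hk 1 e le_rfl he1 hed)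
          (l := ![![0, 1, m j, m k], ![0, 0, n j, n k], ![0, 0, 0, c], 0])
          one_ne_zero (hm j) (hm k)
          (Prod.ext (by simpa using hmn j hj hj' 1 le_rfl (by omega))
            (by simpa using hmn j hj hj' e he hed))
          (Prod.ext (by simpa using hmn k hk' hk 1 le_rfl (by omega))
            (by simpa using hmn k hk' hk e he hed))
          (Prod.ext (by simpa using h 1 le_rfl (by omega)) (by simpa using h e he hed))
          d₁₂ d₁₃ d₂₃
      refine ⟨c * m j / a, div_ne_zero (mul_ne_zero hc (hm j)) ha, fun x hx hxd => ?_⟩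
      field_simp
      linear_combination m j * h x hx hxd - v 1 k x * heq
  choose! μ hμ hμv using hthird
  refine ⟨fun i a => if i = 1 then 0 else m i * v 1 i a, fun i j => if i = 1 then m j else μ i j,
    fun i j hi hij hj => ?_⟩
  have hj1 : j ≠ 1 := by omega
  obtain rfl | hi := hi.eq_or_lt
  · simpa [hj1] using hm j
  · simp only [hj1, hi.ne', if_false]
    exact ⟨hμ i j hi hij hj, fun a ha had => by linear_combination hμv i j hi hij hj a ha had⟩
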